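/- Let c > 0 be fixed and define, for a c-admissible positive harmonic function H on S' and s ≥ 0: G₁(s) := ∫_{l ≥ 0} H(−η̄ b^{-1} s + l) dl and G₂(s) := ∫_{l ≥ 0} H(b^{-1} s − η̄ l) dl. Then there is a constant c' > 0, depending only on η and c, such that for every c-admissible H, all s > 0 and i = 1, 2: E(G_i)(s) ≤ c' and E(G_i)(s) → 0 as s → ∞; moreover E(s ↦ H(ζ_s))(s) ≤ c' and E(s ↦ H(ζ_s))(s) → 0 as s → ∞. -/

import Mathlib

open MeasureTheory Filter Set
open scoped ENNReal Topology

noncomputable section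

/-- `η = a + ib`. -/
def etaC (a b : ℝ) : ℂ := (a : ℂ) + (b : ℂ) * Complex.I

/-- The open sector `S = {u+iv : v > 0, bu + av > 0}`. -/
def sectorS (a b : ℝ) : Set ℂ := {z : ℂ | 0 < z.im ∧ 0 < b * z.re + a * z.im}

/-- The larger sector `S' = {u+iv : v > -log 3, bu + av > -log 3}`. -/
def sectorS' (a b : ℝ) : Set ℂ :=
  {z : ℂ | -Real.log 3 < z.im ∧ -Real.log 3 < b * z.re + a * z.im}

/-- A real-valued function on `ℂ` is harmonic on a set: it is `C²` there and its Laplacian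
(the sum of the second derivatives in the directions `1` and `i`) vanishes. -/
def HarmonicOnSet (f : ℂ → ℝ) (U : Set ℂ) : Prop :=
  ContDiffOn ℝ 2 f U ∧
    ∀ z ∈ U, (iteratedFDeriv ℝ 2 f z) ![1, 1] + (iteratedFDeriv ℝ 2 f z) ![Complex.I, Complex.I] = 0

/-- A positive harmonic function on the sector `S'`. -/
def PosHarmonic (a b : ℝ) (H : ℂ → ℝ) : Prop :=
  (∀ z ∈ sectorS' a b, 0 < H z) ∧ HarmonicOnSet H (sectorS' a b)

/-- The exponent `γ = π/θ₀`, where `θ₀ = arg(-η̄) ∈ (0,π)` is the opening angle of `S`. -/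
def gammaExp (a b : ℝ) : ℝ := Real.pi / Complex.arg (((-a : ℝ) : ℂ) + (b : ℂ) * Complex.I)

/-- `c`-admissibility of a function `H` on `S'`: there is `H̃` with `H̃ ∘ Φ = H` on `S`
(where `Φ(ζ) = ζ^γ`), continuous on the closed upper half-plane, bounded by `c` on `ℝ`,
with `∫_ℝ H̃(t)|t|^{-1+1/γ} dt ≤ c`, and satisfying the Poisson formula. -/
def Admissible (a b c : ℝ) (H : ℂ → ℝ) : Prop :=
  ∃ Ht : ℂ → ℝ,
    ContinuousOn Ht {z : ℂ | 0 ≤ z.im} ∧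
    (∀ ζ ∈ sectorS a b, Ht (ζ ^ ((gammaExp a b : ℝ) : ℂ)) = H ζ) ∧
    (∀ t : ℝ, Ht (t : ℂ) ≤ c) ∧
    Integrable (fun t : ℝ => Ht (t : ℂ) * |t| ^ (-1 + 1 / gammaExp a b)) ∧
    (∫ t : ℝ, Ht (t : ℂ) * |t| ^ (-1 + 1 / gammaExp a b)) ≤ c ∧
    (∀ U V : ℝ, 0 < V →
      Ht ((U : ℂ) + (V : ℂ) * Complex.I) =
        (1 / Real.pi) * ∫ t : ℝ, Ht (t : ℂ) * (V / (V ^ 2 + (t - U) ^ 2)))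

/-- The point `-η̄ b⁻¹ s + l` on the half-line `Λ_{1,s}`. -/
def lam1pt (a b s l : ℝ) : ℂ :=
  -(starRingEnd ℂ (etaC a b)) * ((s / b : ℝ) : ℂ) + (l : ℂ)

/-- The point `b⁻¹ s - η̄ l` on the half-line `Λ_{2,s}`. -/
def lam2pt (a b s l : ℝ) : ℂ :=
  ((s / b : ℝ) : ℂ) - (starRingEnd ℂ (etaC a b)) * (l : ℂ)

/-- The point `ζ_s = (1-η̄) b⁻¹ s`. -/
def zetaPt (a b s : ℝ) : ℂ := (1 - starRingEnd ℂ (etaC a b)) * ((s / b : ℝ) : ℂ)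

/-- `G₁(s) = ∫_{l ≥ 0} H(-η̄ b⁻¹ s + l) dl`. -/
def G1 (a b : ℝ) (H : ℂ → ℝ) (s : ℝ) : ℝ≥0∞ :=
  ∫⁻ l in Set.Ici (0 : ℝ), ENNReal.ofReal (H (lam1pt a b s l))

/-- `G₂(s) = ∫_{l ≥ 0} H(b⁻¹ s - η̄ l) dl`. -/
def G2 (a b : ℝ) (H : ℂ → ℝ) (s : ℝ) : ℝ≥0∞ :=
  ∫⁻ l in Set.Ici (0 : ℝ), ENNReal.ofReal (H (lam2pt a b s l))

/-- The expectation `E(f)(s) = s⁻¹ ∫₀^s f(š) dš`, the mean value of `f` on `(0, s]`. -/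
def Ee (f : ℝ → ℝ≥0∞) (s : ℝ) : ℝ≥0∞ :=
  (ENNReal.ofReal s)⁻¹ * ∫⁻ t in Set.Ioc (0 : ℝ) s, f t

/-- The Poisson kernel of the upper half-plane at `r ^ γ * exp (i γ θ)` and `t`, weighted by
`|t| ^ (1 - 1 / γ)`. -/
def polarKernel (γ r θ t : ℝ) : ℝ :=
  |t| ^ (1 - 1 / γ) * (r ^ γ * Real.sin (γ * θ) /
    ((r ^ γ * Real.sin (γ * θ)) ^ 2 + (t - r ^ γ * Real.cos (γ * θ)) ^ 2))

lemma sin_mul_le_mul_sin {γ θ : ℝ} (hγ : 1 ≤ γ) (hθ : 0 ≤ θ) (hγθ : γ * θ ≤ Real.pi) :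
    Real.sin (γ * θ) ≤ γ * Real.sin θ := by
  have hγ0 : 0 < γ := by linarith
  have hmem : γ * θ ∈ Icc 0 Real.pi := ⟨by positivity, hγθ⟩
  have hmem0 : (0 : ℝ) ∈ Icc 0 Real.pi := ⟨le_rfl, Real.pi_pos.le⟩
  have hw : 0 ≤ 1 - 1 / γ := by rw [sub_nonneg, div_le_one hγ0]; exact hγ
  have h := strictConcaveOn_sin_Icc.concaveOn.2 hmem hmem0
    (show 0 ≤ 1 / γ by positivity) hw (by ring)
  simp only [smul_eq_mul, Real.sin_zero, mul_zero, add_zero] at h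
  rw [show 1 / γ * (γ * θ) = θ by field_simp] at h
  calc Real.sin (γ * θ) = γ * (1 / γ * Real.sin (γ * θ)) := by field_simp
    _ ≤ γ * Real.sin θ := by gcongr

lemma rpow_eq_rpow_sub_one_mul {γ r : ℝ} (hr : 0 < r) : r ^ γ = r ^ (γ - 1) * r := by
  rw [← Real.rpow_add_one hr.ne']; ring_nf

lemma rpow_one_sub_inv {γ t : ℝ} (hγ : 1 < γ) (ht : 0 < t) :
    t ^ (1 - 1 / γ) = (t ^ (1 / γ)) ^ (γ - 1) := by
  rw [← Real.rpow_mul ht.le]; congr 1; field_simp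

lemma eq_root_rpow_mul {γ t : ℝ} (hγ : 1 < γ) (ht : 0 < t) :
    t = (t ^ (1 / γ)) ^ (γ - 1) * t ^ (1 / γ) := by
  rw [← rpow_one_sub_inv hγ ht, ← Real.rpow_add ht]; simp

/-- On `0 < θ < π / γ` the kernel of the sector is dominated by that of the half-plane. -/
lemma polarKernel_le_of_pos {γ r θ t : ℝ} (hγ : 1 < γ) (hr : 0 < r) (hθ : 0 < θ)
    (hγθ : γ * θ < Real.pi) (ht : 0 < t) :
    polarKernel γ r θ t ≤
      γ * (r * Real.sin θ / ((r * Real.sin θ) ^ 2 + (t ^ (1 / γ) - r * Real.cos θ) ^ 2)) := by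
  have hS := sin_mul_le_mul_sin hγ.le hθ.le hγθ.le
  have hγθ0 : θ < γ * θ := by nlinarith
  have hC : Real.cos (γ * θ) ≤ Real.cos θ :=
    Real.cos_le_cos_of_nonneg_of_le_pi hθ.le hγθ.le hγθ0.le
  have hs : 0 < Real.sin θ := Real.sin_pos_of_pos_of_lt_pi hθ (by linarith)
  have hS0 : 0 < Real.sin (γ * θ) := Real.sin_pos_of_pos_of_lt_pi (by positivity) hγθ
  have h1 := Real.sin_sq_add_cos_sq θ
  have h2 := Real.sin_sq_add_cos_sq (γ * θ)
  unfold polarKernel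
  rw [abs_of_pos ht, rpow_one_sub_inv hγ ht]
  nth_rewrite 2 [eq_root_rpow_mul hγ ht]
  rw [rpow_eq_rpow_sub_one_mul hr]
  have hτ : 0 < t ^ (1 / γ) := by positivity
  generalize t ^ (1 / γ) = τ at *
  have hpq : 0 ≤ (r ^ (γ - 1) * r ^ 2 - τ ^ (γ - 1) * τ ^ 2) * (r ^ (γ - 1) - τ ^ (γ - 1)) := by
    rcases le_total r τ with h | h
    · have : r ^ (γ - 1) ≤ τ ^ (γ - 1) := by gcongr
      apply mul_nonneg_of_nonpos_of_nonpos <;> rw [sub_nonpos]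
      · gcongr
      · exact this
    · have : τ ^ (γ - 1) ≤ r ^ (γ - 1) := by gcongr
      apply mul_nonneg <;> rw [sub_nonneg]
      · gcongr
      · exact this
  have hp : 0 < r ^ (γ - 1) := by positivity
  have hq : 0 < τ ^ (γ - 1) := by positivity
  generalize r ^ (γ - 1) = p at *
  generalize τ ^ (γ - 1) = q at *
  generalize Real.sin θ = s at *
  generalize Real.cos θ = c at *
  generalize Real.sin (γ * θ) = S at *
  generalize Real.cos (γ * θ) = C at *
  have hD1 : (r * s) ^ 2 + (τ - r * c) ^ 2 = r ^ 2 + τ ^ 2 - 2 * r * τ * c := by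
    linear_combination r ^ 2 * h1
  have hD2 : (p * r * S) ^ 2 + (q * τ - p * r * C) ^ 2
      = p ^ 2 * r ^ 2 + q ^ 2 * τ ^ 2 - 2 * p * q * r * τ * C := by
    linear_combination p ^ 2 * r ^ 2 * h2
  have hDD : p * q * ((r * s) ^ 2 + (τ - r * c) ^ 2)
      ≤ (p * r * S) ^ 2 + (q * τ - p * r * C) ^ 2 := by
    rw [hD1, hD2]
    have : 0 ≤ (p * q * r * τ) * (c - C) := mul_nonneg (by positivity) (by linarith)
    nlinarith
  have hD1p : 0 < (r * s) ^ 2 + (τ - r * c) ^ 2 := by positivity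
  have hD2p : 0 < (p * r * S) ^ 2 + (q * τ - p * r * C) ^ 2 := by positivity
  rw [← mul_div_assoc, ← mul_div_assoc, div_le_div_iff₀ hD2p hD1p]
  calc q * (p * r * S) * ((r * s) ^ 2 + (τ - r * c) ^ 2)
      = S * (r * (p * q * ((r * s) ^ 2 + (τ - r * c) ^ 2))) := by ring
    _ ≤ (γ * s) * (r * ((p * r * S) ^ 2 + (q * τ - p * r * C) ^ 2)) := by gcongr
    _ = _ := by ring

lemma polarKernel_reflect {γ θ₀ : ℝ} (hγ : γ * θ₀ = Real.pi) (r θ t : ℝ) :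
    polarKernel γ r (θ₀ - θ) (-t) = polarKernel γ r θ t := by
  unfold polarKernel
  rw [mul_sub, hγ, Real.sin_pi_sub, Real.cos_pi_sub, abs_neg]
  congr 3
  ring

lemma polarKernel_le_of_far {γ r θ t : ℝ} (hr : 0 < r)
    (hrt : 2 * |t| ≤ r ^ γ) :
    polarKernel γ r θ t ≤ |t| ^ (1 - 1 / γ) * (4 / r ^ γ) := by
  unfold polarKernel
  have hA : 0 < r ^ γ := by positivity
  generalize r ^ γ = A at *
  have h2 := Real.sin_sq_add_cos_sq (γ * θ)
  have hS := Real.sin_le_one (γ * θ)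
  have hC := Real.abs_cos_le_one (γ * θ)
  generalize Real.sin (γ * θ) = S at *
  generalize Real.cos (γ * θ) = C at *
  have h3 : t * C ≤ |t| := by
    calc t * C ≤ |t * C| := le_abs_self _
      _ = |t| * |C| := abs_mul _ _
      _ ≤ |t| * 1 := by gcongr
      _ = |t| := mul_one _
  have hD : A ^ 2 / 4 ≤ (A * S) ^ 2 + (t - A * C) ^ 2 := by
    have e : (A * S) ^ 2 + (t - A * C) ^ 2 = A ^ 2 + |t| ^ 2 - 2 * A * (t * C) := by
      rw [sq_abs]; linear_combination A ^ 2 * h2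
    rw [e]
    nlinarith [abs_nonneg t]
  refine mul_le_mul_of_nonneg_left ?_ (by positivity)
  rw [div_le_div_iff₀ (lt_of_lt_of_le (by positivity) hD) hA]
  nlinarith

lemma polarKernel_le_of_neg {γ r θ t : ℝ} (hγ : 1 < γ) (hr : 0 < r) (hθ : 0 < θ)
    (hγθ : γ * θ ≤ Real.pi / 2) (ht : t < 0) :
    polarKernel γ r θ t ≤ γ * (r * Real.sin θ / r ^ 2) := by
  have hpi := Real.pi_pos
  have hS := sin_mul_le_mul_sin hγ.le hθ.le (by linarith)
  have hS0 : 0 < Real.sin (γ * θ) :=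
    Real.sin_pos_of_pos_of_lt_pi (by positivity) (by linarith)
  have hC0 : 0 ≤ Real.cos (γ * θ) :=
    Real.cos_nonneg_of_neg_pi_div_two_le_of_le (by nlinarith) hγθ
  have hs : 0 < Real.sin θ := Real.sin_pos_of_pos_of_lt_pi hθ (by nlinarith)
  have h2 := Real.sin_sq_add_cos_sq (γ * θ)
  unfold polarKernel
  obtain ⟨u, rfl⟩ : ∃ u, t = -u := ⟨-t, by ring⟩
  have hu : 0 < u := by linarith
  rw [abs_neg, abs_of_pos hu, rpow_one_sub_inv hγ hu]
  nth_rewrite 2 [eq_root_rpow_mul hγ hu]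
  rw [rpow_eq_rpow_sub_one_mul hr]
  have hτ : 0 < u ^ (1 / γ) := by positivity
  generalize u ^ (1 / γ) = τ at *
  have hpq : r ^ (γ - 1) * τ ^ (γ - 1) * r ^ 2
      ≤ (r ^ (γ - 1)) ^ 2 * r ^ 2 + (τ ^ (γ - 1)) ^ 2 * τ ^ 2 := by
    rcases le_total r τ with h | h
    · have : r ^ (γ - 1) ≤ τ ^ (γ - 1) := by gcongr
      calc _ ≤ τ ^ (γ - 1) * τ ^ (γ - 1) * τ ^ 2 := by gcongr
        _ ≤ _ := by nlinarith [sq_nonneg (r ^ (γ - 1) * r)]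
    · have : τ ^ (γ - 1) ≤ r ^ (γ - 1) := by gcongr
      calc _ ≤ r ^ (γ - 1) * r ^ (γ - 1) * r ^ 2 := by gcongr
        _ ≤ _ := by nlinarith [sq_nonneg (τ ^ (γ - 1) * τ)]
  have hp : 0 < r ^ (γ - 1) := by positivity
  have hq : 0 < τ ^ (γ - 1) := by positivity
  generalize r ^ (γ - 1) = p at *
  generalize τ ^ (γ - 1) = q at *
  generalize Real.sin θ = s at *
  generalize Real.sin (γ * θ) = S at *
  generalize Real.cos (γ * θ) = C at *
  have hD : p ^ 2 * r ^ 2 + q ^ 2 * τ ^ 2 ≤ (p * r * S) ^ 2 + (-(q * τ) - p * r * C) ^ 2 := by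
    have : 0 ≤ p * q * r * τ * C := by positivity
    have e : (p * r * S) ^ 2 + (-(q * τ) - p * r * C) ^ 2
        = p ^ 2 * r ^ 2 + q ^ 2 * τ ^ 2 + 2 * (p * q * r * τ * C) := by
      linear_combination p ^ 2 * r ^ 2 * h2
    linarith
  rw [← mul_div_assoc, ← mul_div_assoc, div_le_div_iff₀ (by positivity) (by positivity)]
  calc q * (p * r * S) * r ^ 2 = S * (r * (p * q * r ^ 2)) := by ring
    _ ≤ (γ * s) * (r * ((p * r * S) ^ 2 + (-(q * τ) - p * r * C) ^ 2)) := by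
        gcongr; exact hpq.trans hD
    _ = _ := by ring

/-- The Poisson kernel of the upper half-plane at `ζ ^ γ` and `t`, up to the factor `1 / π`,
weighted by `|t| ^ (1 - 1 / γ)`. -/
def sectorKernel (γ : ℝ) (ζ : ℂ) (t : ℝ) : ℝ :=
  |t| ^ (1 - 1 / γ) * ((ζ ^ (γ : ℂ)).im /
    ((ζ ^ (γ : ℂ)).im ^ 2 + (t - (ζ ^ (γ : ℂ)).re) ^ 2))

/-- The point with coordinates `X`, `Y` along the unit vectors of arguments `0` and `θ₀`. -/
def sectorPoint (θ₀ X Y : ℝ) : ℂ :=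
  (X : ℂ) + (Y : ℂ) * ((Real.cos θ₀ : ℂ) + (Real.sin θ₀ : ℂ) * Complex.I)

@[simp] lemma sectorPoint_re (θ₀ X Y : ℝ) :
    (sectorPoint θ₀ X Y).re = X + Y * Real.cos θ₀ := by
  simp [sectorPoint, -Complex.ofReal_cos, -Complex.ofReal_sin]

@[simp] lemma sectorPoint_im (θ₀ X Y : ℝ) : (sectorPoint θ₀ X Y).im = Y * Real.sin θ₀ := by
  simp [sectorPoint, -Complex.ofReal_cos, -Complex.ofReal_sin]

lemma measurable_sectorKernel (γ θ₀ : ℝ) :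
    Measurable fun p : ℝ × ℝ × ℝ => sectorKernel γ (sectorPoint θ₀ p.1 p.2.1) p.2.2 := by
  have h : Measurable fun p : ℝ × ℝ × ℝ => (sectorPoint θ₀ p.1 p.2.1) ^ (γ : ℂ) := by
    unfold sectorPoint
    fun_prop
  have hre := Complex.measurable_re.comp h
  have him := Complex.measurable_im.comp h
  simp only [Function.comp_def] at hre him
  unfold sectorKernel
  have habs : Measurable fun p : ℝ × ℝ × ℝ => |p.2.2| :=
    continuous_abs.measurable.comp (by fun_prop)
  fun_prop

lemma cpow_ofReal_of_polar {γ r θ : ℝ} {ζ : ℂ} (hr : 0 < r) (hθ : 0 < θ)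
    (hθπ : θ < Real.pi) (hre : ζ.re = r * Real.cos θ) (him : ζ.im = r * Real.sin θ) :
    (ζ ^ (γ : ℂ)).re = r ^ γ * Real.cos (γ * θ) ∧ (ζ ^ (γ : ℂ)).im = r ^ γ * Real.sin (γ * θ) := by
  have hζ : ζ = (r : ℂ) * (Complex.cos (θ : ℂ) + Complex.sin (θ : ℂ) * Complex.I) := by
    apply Complex.ext
    · simp [hre, ← Complex.ofReal_cos, ← Complex.ofReal_sin]
    · simp [him, ← Complex.ofReal_cos, ← Complex.ofReal_sin]
  have harg : ζ.arg = θ := by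
    rw [hζ]
    exact Complex.arg_mul_cos_add_sin_mul_I hr ⟨by linarith [Real.pi_pos], hθπ.le⟩
  have hnorm : ‖ζ‖ = r := by
    rw [hζ, norm_mul, Complex.norm_cos_add_sin_mul_I, Complex.norm_real, Real.norm_of_nonneg hr.le,
      mul_one]
  rw [Complex.cpow_ofReal, harg, hnorm, mul_comm θ]
  constructor
  · simp only [Complex.mul_re, Complex.add_re, Complex.ofReal_re, Complex.ofReal_im, Complex.I_re,
      Complex.I_im, Complex.add_im, Complex.mul_im]
    ring
  · simp only [Complex.mul_re, Complex.add_re, Complex.ofReal_re, Complex.ofReal_im, Complex.I_re,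
      Complex.I_im, Complex.add_im, Complex.mul_im]
    ring

lemma sectorKernel_eq_polarKernel {γ r θ : ℝ} {ζ : ℂ} (hr : 0 < r) (hθ : 0 < θ)
    (hθπ : θ < Real.pi) (hre : ζ.re = r * Real.cos θ) (him : ζ.im = r * Real.sin θ) (t : ℝ) :
    sectorKernel γ ζ t = polarKernel γ r θ t := by
  obtain ⟨h1, h2⟩ := cpow_ofReal_of_polar (γ := γ) hr hθ hθπ hre him
  rw [sectorKernel, polarKernel, h1, h2]

lemma exists_polar_of_im_pos {z : ℂ} (hz : 0 < z.im) :
    ∃ r θ : ℝ, 0 < r ∧ 0 < θ ∧ θ < Real.pi ∧ z.re = r * Real.cos θ ∧ z.im = r * Real.sin θ := by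
  have hz0 : z ≠ 0 := by rintro rfl; simp at hz
  have hn : 0 < ‖z‖ := norm_pos_iff.2 hz0
  have hs : 0 < ‖z‖ * Real.sin z.arg := by rwa [Complex.norm_mul_sin_arg]
  have hs' : 0 < Real.sin z.arg := by
    by_contra! h
    exact absurd hs (not_lt.2 (mul_nonpos_of_nonneg_of_nonpos hn.le h))
  refine ⟨‖z‖, z.arg, hn, ?_, Complex.arg_lt_pi_iff.2 (Or.inr hz.ne'),
    (Complex.norm_mul_cos_arg z).symm, (Complex.norm_mul_sin_arg z).symm⟩
  by_contra! h
  exact absurd hs' (not_lt.2 (Real.sin_nonpos_of_nonpos_of_neg_pi_le h (Complex.neg_pi_lt_arg z).le))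

lemma sectorPoint_polar {θ₀ X Y : ℝ} (h0 : 0 < θ₀) (hπ : θ₀ < Real.pi) (hX : 0 < X)
    (hY : 0 < Y) :
    ∃ r θ : ℝ, 0 < r ∧ 0 < θ ∧ θ < θ₀ ∧ X + Y * Real.cos θ₀ = r * Real.cos θ ∧
      Y * Real.sin θ₀ = r * Real.sin θ ∧ X * Real.sin θ₀ = r * Real.sin (θ₀ - θ) ∧
      Y + X * Real.cos θ₀ = r * Real.cos (θ₀ - θ) := by
  have hs := Real.sin_pos_of_pos_of_lt_pi h0 hπ
  obtain ⟨r, θ, hr, hθ, hθπ, hre, him⟩ :=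
    exists_polar_of_im_pos (z := sectorPoint θ₀ X Y) (by simp; positivity)
  rw [sectorPoint_re] at hre
  rw [sectorPoint_im] at him
  have h1 := Real.sin_sq_add_cos_sq θ₀
  have hX' : X * Real.sin θ₀ = r * Real.sin (θ₀ - θ) := by
    rw [Real.sin_sub]
    linear_combination Real.sin θ₀ * hre - Real.cos θ₀ * him
  refine ⟨r, θ, hr, hθ, ?_, hre, him, hX', ?_⟩
  · by_contra! h
    have h3 : Real.sin (θ₀ - θ) ≤ 0 :=
      Real.sin_nonpos_of_nonpos_of_neg_pi_le (by linarith) (by linarith)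
    nlinarith [mul_pos hX hs]
  · rw [Real.cos_sub]
    linear_combination Real.cos θ₀ * hre + Real.sin θ₀ * him - Y * h1

section Bounds

variable {γ θ₀ : ℝ}

lemma sectorKernel_swap (h0 : 0 < θ₀) (hπ : θ₀ < Real.pi) (hγθ : γ * θ₀ = Real.pi) {X Y : ℝ}
    (hX : 0 < X) (hY : 0 < Y) (t : ℝ) :
    sectorKernel γ (sectorPoint θ₀ Y X) (-t) = sectorKernel γ (sectorPoint θ₀ X Y) t := by
  obtain ⟨r, θ, hr, hθ, hθ0, h1, h2, h3, h4⟩ := sectorPoint_polar h0 hπ hX hY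
  rw [sectorKernel_eq_polarKernel (ζ := sectorPoint θ₀ X Y) hr hθ (by linarith) (by simpa)
      (by simpa),
    sectorKernel_eq_polarKernel (ζ := sectorPoint θ₀ Y X) hr (θ := θ₀ - θ) (by linarith)
      (by linarith) (by simpa) (by simpa),
    polarKernel_reflect hγθ]

lemma sectorKernel_le_of_pos (h0 : 0 < θ₀) (hπ : θ₀ < Real.pi) (hγ : 1 < γ)
    (hγθ : γ * θ₀ = Real.pi) {X Y t : ℝ} (hX : 0 < X) (hY : 0 < Y) (ht : 0 < t) :
    sectorKernel γ (sectorPoint θ₀ X Y) t ≤ γ * (Y * Real.sin θ₀ /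
      ((Y * Real.sin θ₀) ^ 2 + (t ^ (1 / γ) - (X + Y * Real.cos θ₀)) ^ 2)) := by
  obtain ⟨r, θ, hr, hθ, hθ0, h1, h2, -, -⟩ := sectorPoint_polar h0 hπ hX hY
  rw [sectorKernel_eq_polarKernel (ζ := sectorPoint θ₀ X Y) hr hθ (by linarith) (by simpa)
      (by simpa), h1, h2]
  exact polarKernel_le_of_pos hγ hr hθ (by nlinarith) ht

lemma sectorKernel_le_of_neg (h0 : 0 < θ₀) (hπ : θ₀ < Real.pi) (hγ : 1 < γ)
    (hγθ : γ * θ₀ = Real.pi) {X Y t : ℝ} (hX : 0 < X) (hY : 0 < Y) (ht : t < 0) :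
    sectorKernel γ (sectorPoint θ₀ X Y) t ≤ γ * (X * Real.sin θ₀ /
      ((X * Real.sin θ₀) ^ 2 + ((-t) ^ (1 / γ) - (Y + X * Real.cos θ₀)) ^ 2)) := by
  rw [← sectorKernel_swap h0 hπ hγθ hX hY]
  exact sectorKernel_le_of_pos h0 hπ hγ hγθ hY hX (by linarith)

lemma sectorKernel_le_of_neg_of_le (h0 : 0 < θ₀) (hπ : θ₀ < Real.pi) (hγ : 1 < γ)
    (hγθ : γ * θ₀ = Real.pi) {X Y t : ℝ} (hX : 0 < X) (hY : 0 < Y) (hYX : Y ≤ X) (ht : t < 0) :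
    sectorKernel γ (sectorPoint θ₀ X Y) t ≤
      γ * (Y * Real.sin θ₀ / (X * Real.sin θ₀) ^ 2) := by
  have hs := Real.sin_pos_of_pos_of_lt_pi h0 hπ
  obtain ⟨r, θ, hr, hθ, hθ0, h1, h2, h3, h4⟩ := sectorPoint_polar h0 hπ hX hY
  rw [sectorKernel_eq_polarKernel (ζ := sectorPoint θ₀ X Y) hr hθ (by linarith) (by simpa)
      (by simpa)]
  have hhalf : θ ≤ θ₀ / 2 := by
    by_contra! h
    have : Real.sin (θ₀ - θ) < Real.sin θ := by
      have e : Real.sin θ - Real.sin (θ₀ - θ)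
          = 2 * Real.sin (θ - θ₀ / 2) * Real.cos (θ₀ / 2) := by
        rw [Real.sin_sub_sin]; ring_nf
      have h5 : 0 < Real.sin (θ - θ₀ / 2) :=
        Real.sin_pos_of_pos_of_lt_pi (by linarith) (by linarith)
      have h6 : 0 < Real.cos (θ₀ / 2) :=
        Real.cos_pos_of_mem_Ioo ⟨by linarith, by linarith⟩
      have := mul_pos (mul_pos two_pos h5) h6
      linarith
    have : r * Real.sin (θ₀ - θ) < r * Real.sin θ := by gcongr
    nlinarith
  refine (polarKernel_le_of_neg hγ hr hθ (by nlinarith) ht).trans ?_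
  rw [← h2]
  have hrX : X * Real.sin θ₀ ≤ r := by
    rw [h3]; nlinarith [Real.sin_le_one (θ₀ - θ)]
  have hγ0 : 0 ≤ γ := by linarith
  gcongr

lemma sectorKernel_le_of_far (h0 : 0 < θ₀) (hπ : θ₀ < Real.pi) (hγ : 1 < γ) {X Y t : ℝ}
    (hX : 0 < X) (hY : 0 < Y) (ht : 2 * |t| ≤ (Real.sin θ₀ / 2 * (X + Y)) ^ γ) :
    sectorKernel γ (sectorPoint θ₀ X Y) t ≤
      |t| ^ (1 - 1 / γ) * (4 / (Real.sin θ₀ / 2 * (X + Y)) ^ γ) := by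
  have hs := Real.sin_pos_of_pos_of_lt_pi h0 hπ
  obtain ⟨r, θ, hr, hθ, hθ0, h1, h2, h3, h4⟩ := sectorPoint_polar h0 hπ hX hY
  rw [sectorKernel_eq_polarKernel (ζ := sectorPoint θ₀ X Y) hr hθ (by linarith) (by simpa)
      (by simpa)]
  have hrXY : Real.sin θ₀ / 2 * (X + Y) ≤ r := by
    nlinarith [Real.sin_le_one (θ₀ - θ), Real.sin_le_one θ]
  have hγ0 : 0 ≤ γ := by linarith
  have hpow : (Real.sin θ₀ / 2 * (X + Y)) ^ γ ≤ r ^ γ := by gcongr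
  refine (polarKernel_le_of_far hr (ht.trans hpow)).trans ?_
  gcongr

lemma sectorKernel_le_of_ne (h0 : 0 < θ₀) (hπ : θ₀ < Real.pi) (hγ : 1 < γ)
    (hγθ : γ * θ₀ = Real.pi) {X Y t : ℝ} (hX : 0 < X) (hY : 0 < Y) (ht : t ≠ 0) :
    sectorKernel γ (sectorPoint θ₀ X Y) t ≤ γ / (min X Y * Real.sin θ₀) := by
  have hs := Real.sin_pos_of_pos_of_lt_pi h0 hπ
  have hm : 0 < min X Y := lt_min hX hY
  have key : ∀ {V D : ℝ}, min X Y ≤ V → γ * (V * Real.sin θ₀ / ((V * Real.sin θ₀) ^ 2 + D ^ 2)) ≤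
      γ / (min X Y * Real.sin θ₀) := by
    intro V D hV
    have hV0 : 0 < V := hm.trans_le hV
    rw [div_eq_mul_inv γ]
    refine mul_le_mul_of_nonneg_left ?_ (by linarith)
    calc V * Real.sin θ₀ / ((V * Real.sin θ₀) ^ 2 + D ^ 2)
        ≤ V * Real.sin θ₀ / (V * Real.sin θ₀) ^ 2 := by
          gcongr; linarith [sq_nonneg D]
      _ = (V * Real.sin θ₀)⁻¹ := by field_simp
      _ ≤ (min X Y * Real.sin θ₀)⁻¹ := by gcongr
  rcases lt_or_gt_of_ne ht with h | h
  · exact (sectorKernel_le_of_neg h0 hπ hγ hγθ hX hY h).trans (key (min_le_left _ _))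
  · exact (sectorKernel_le_of_pos h0 hπ hγ hγθ hX hY h).trans (key (min_le_right _ _))

end Bounds

lemma lintegral_poisson {v α : ℝ} (hv : 0 < v) (hα : 0 < α) (d : ℝ) :
    ∫⁻ x, ENNReal.ofReal (v / (v ^ 2 + (d - α * x) ^ 2)) = ENNReal.ofReal (Real.pi / α) := by
  have e : ∀ x : ℝ, v / (v ^ 2 + (d - α * x) ^ 2)
      = v⁻¹ * (fun y => (1 + (y - d / v) ^ 2)⁻¹) (α / v * x) := by
    intro x
    have : 0 < v ^ 2 + (d - α * x) ^ 2 := by positivity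
    have : 0 < 1 + (α / v * x - d / v) ^ 2 := by positivity
    have e1 : 1 + (α / v * x - d / v) ^ 2 = (v ^ 2 + (d - α * x) ^ 2) / v ^ 2 := by
      field_simp; ring
    simp only [e1]
    field_simp
  have hint : Integrable fun x : ℝ => v⁻¹ * (fun y => (1 + (y - d / v) ^ 2)⁻¹) (α / v * x) :=
    ((integrable_inv_one_add_sq.comp_sub_right (d / v)).comp_mul_left' (by positivity)).const_mul _
  simp_rw [e]
  rw [← ofReal_integral_eq_lintegral_ofReal hint
    (Eventually.of_forall fun x => by dsimp only; positivity), integral_const_mul,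
    Measure.integral_comp_mul_left (fun y : ℝ => (1 + (y - d / v) ^ 2)⁻¹),
    integral_sub_right_eq_self (fun y : ℝ => (1 + y ^ 2)⁻¹), integral_univ_inv_one_add_sq,
    smul_eq_mul, abs_of_pos (by positivity)]
  congr 1
  field_simp

section Integrals

variable {γ θ₀ α β : ℝ}

lemma lintegral_sectorKernel_le_of_pos (h0 : 0 < θ₀) (hπ : θ₀ < Real.pi) (hγ : 1 < γ)
    (hγθ : γ * θ₀ = Real.pi) (hα : 0 < α) {Y t : ℝ} (hY : 0 < Y) (ht : 0 < t) :
    ∫⁻ x in Ioi 0, ENNReal.ofReal (sectorKernel γ (sectorPoint θ₀ (α * x) Y) t)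
      ≤ ENNReal.ofReal (γ * (Real.pi / α)) := by
  have hs := Real.sin_pos_of_pos_of_lt_pi h0 hπ
  calc _ ≤ ∫⁻ x in Ioi 0, ENNReal.ofReal (γ * (Y * Real.sin θ₀ / ((Y * Real.sin θ₀) ^ 2 +
          ((t ^ (1 / γ) - Y * Real.cos θ₀) - α * x) ^ 2))) := by
        refine setLIntegral_mono' measurableSet_Ioi fun x (hx : 0 < x) => ?_
        refine ENNReal.ofReal_le_ofReal
          ((sectorKernel_le_of_pos h0 hπ hγ hγθ (mul_pos hα hx) hY ht).trans_eq ?_)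
        congr 4
        ring
    _ ≤ ∫⁻ x, ENNReal.ofReal (γ * (Y * Real.sin θ₀ / ((Y * Real.sin θ₀) ^ 2 +
          ((t ^ (1 / γ) - Y * Real.cos θ₀) - α * x) ^ 2))) := setLIntegral_le_lintegral _ _
    _ = _ := by
        have hγ0 : 0 ≤ γ := by linarith
        simp_rw [ENNReal.ofReal_mul hγ0]
        rw [lintegral_const_mul' _ _ ENNReal.ofReal_ne_top, lintegral_poisson (by positivity) hα]

lemma lintegral_sectorKernel_le_of_neg (h0 : 0 < θ₀) (hπ : θ₀ < Real.pi) (hγ : 1 < γ)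
    (hγθ : γ * θ₀ = Real.pi) (hβ : 0 < β) {X t : ℝ} (hX : 0 < X) (ht : t < 0) :
    ∫⁻ y in Ioi 0, ENNReal.ofReal (sectorKernel γ (sectorPoint θ₀ X (β * y)) t)
      ≤ ENNReal.ofReal (γ * (Real.pi / β)) := by
  refine le_trans (le_of_eq ?_)
    (lintegral_sectorKernel_le_of_pos h0 hπ hγ hγθ hβ hX (neg_pos.2 ht))
  refine setLIntegral_congr_fun measurableSet_Ioi fun y (hy : 0 < y) => ?_
  simp only [sectorKernel_swap h0 hπ hγθ hX (mul_pos hβ hy)]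

lemma measurable_ofReal_sectorKernel (γ θ₀ α β : ℝ) :
    Measurable fun p : ℝ × ℝ × ℝ =>
      ENNReal.ofReal (sectorKernel γ (sectorPoint θ₀ (α * p.1) (β * p.2.1)) p.2.2) :=
  ((measurable_sectorKernel γ θ₀).comp
    (show Measurable fun p : ℝ × ℝ × ℝ => (α * p.1, β * p.2.1, p.2.2) by fun_prop)).ennreal_ofReal

lemma lintegral_Ioi_inv_sq {r : ℝ} (hr : 0 < r) :
    ∫⁻ x in Ioi r, ENNReal.ofReal (x ^ (-2 : ℝ)) = ENNReal.ofReal r⁻¹ := by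
  rw [← ofReal_integral_eq_lintegral_ofReal (integrableOn_Ioi_rpow_of_lt (by norm_num) hr),
    integral_Ioi_rpow_of_lt (by norm_num) hr]
  · norm_num [Real.rpow_neg_one]
  · filter_upwards [ae_restrict_mem measurableSet_Ioi] with x hx
    exact Real.rpow_nonneg (hr.trans hx).le _

lemma lintegral_strip_sectorKernel_le_of_neg (h0 : 0 < θ₀) (hπ : θ₀ < Real.pi) (hγ : 1 < γ)
    (hγθ : γ * θ₀ = Real.pi) (hα : 0 < α) (hβ : 0 < β) {s t : ℝ} (hs : 0 < s) (ht : t < 0) :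
    ∫⁻ y in Ioc 0 s, ∫⁻ x in Ioi 0,
      ENNReal.ofReal (sectorKernel γ (sectorPoint θ₀ (α * x) (β * y)) t)
      ≤ ENNReal.ofReal ((γ * (Real.pi / α) + γ / (α * Real.sin θ₀)) * s) := by
  have hsin := Real.sin_pos_of_pos_of_lt_pi h0 hπ
  have hpi := Real.pi_pos
  have hγ0 : 0 < γ := by linarith
  have hr : 0 < β * s / α := by positivity
  have hmeas : Measurable fun p : ℝ × ℝ =>
      ENNReal.ofReal (sectorKernel γ (sectorPoint θ₀ (α * p.2) (β * p.1)) t) :=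
    (measurable_ofReal_sectorKernel γ θ₀ α β).comp
      (show Measurable fun p : ℝ × ℝ => (p.2, p.1, t) by fun_prop)
  have near : ∫⁻ y in Ioc 0 s, ∫⁻ x in Ioc 0 (β * s / α),
      ENNReal.ofReal (sectorKernel γ (sectorPoint θ₀ (α * x) (β * y)) t)
      ≤ ENNReal.ofReal (γ * (Real.pi / α) * s) := by
    rw [lintegral_lintegral_swap hmeas.aemeasurable]
    calc _ ≤ ∫⁻ x in Ioc 0 (β * s / α), ENNReal.ofReal (γ * (Real.pi / β)) := by
          refine setLIntegral_mono' measurableSet_Ioc fun x hx => ?_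
          exact (lintegral_mono_set Ioc_subset_Ioi_self).trans
            (lintegral_sectorKernel_le_of_neg h0 hπ hγ hγθ hβ (mul_pos hα hx.1) ht)
      _ = _ := by
          rw [setLIntegral_const, Real.volume_Ioc, sub_zero, ← ENNReal.ofReal_mul (by positivity)]
          congr 1
          field_simp
  have far : ∫⁻ y in Ioc 0 s, ∫⁻ x in Ioi (β * s / α),
      ENNReal.ofReal (sectorKernel γ (sectorPoint θ₀ (α * x) (β * y)) t)
      ≤ ENNReal.ofReal (γ / (α * Real.sin θ₀) * s) := by
    have inner : ∀ y ∈ Ioc 0 s, ∫⁻ x in Ioi (β * s / α),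
        ENNReal.ofReal (sectorKernel γ (sectorPoint θ₀ (α * x) (β * y)) t)
        ≤ ENNReal.ofReal (γ / (α * Real.sin θ₀)) := by
      intro y hy
      calc _ ≤ ∫⁻ x in Ioi (β * s / α), ENNReal.ofReal (γ * (β * s) / (α ^ 2 * Real.sin θ₀)) *
              ENNReal.ofReal (x ^ (-2 : ℝ)) := by
            refine setLIntegral_mono' measurableSet_Ioi fun x (hx : β * s / α < x) => ?_
            have hx0 : 0 < x := hr.trans hx
            have hle : β * y ≤ α * x := by
              have h1 : β * s < x * α := (div_lt_iff₀ hα).1 hx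
              nlinarith [hy.2]
            rw [← ENNReal.ofReal_mul (by positivity)]
            refine ENNReal.ofReal_le_ofReal ((sectorKernel_le_of_neg_of_le h0 hπ hγ hγθ
              (mul_pos hα hx0) (mul_pos hβ hy.1) hle ht).trans ?_)
            calc γ * (β * y * Real.sin θ₀ / (α * x * Real.sin θ₀) ^ 2)
                ≤ γ * (β * s * Real.sin θ₀ / (α * x * Real.sin θ₀) ^ 2) := by
                  gcongr; exact hy.2
              _ = _ := by
                  rw [Real.rpow_neg hx0.le, Real.rpow_two]; field_simp
        _ = _ := by
            rw [lintegral_const_mul' _ _ ENNReal.ofReal_ne_top, lintegral_Ioi_inv_sq hr,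
              ← ENNReal.ofReal_mul (by positivity)]
            congr 1
            field_simp
    calc _ ≤ ∫⁻ y in Ioc 0 s, ENNReal.ofReal (γ / (α * Real.sin θ₀)) :=
          setLIntegral_mono' measurableSet_Ioc inner
      _ = _ := by
          rw [setLIntegral_const, Real.volume_Ioc, sub_zero, ← ENNReal.ofReal_mul (by positivity)]
  calc _ ≤ ∫⁻ y in Ioc 0 s, ((∫⁻ x in Ioc 0 (β * s / α),
          ENNReal.ofReal (sectorKernel γ (sectorPoint θ₀ (α * x) (β * y)) t)) +
        ∫⁻ x in Ioi (β * s / α),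
          ENNReal.ofReal (sectorKernel γ (sectorPoint θ₀ (α * x) (β * y)) t)) := by
        refine lintegral_mono fun y => ?_
        rw [← Ioc_union_Ioi_eq_Ioi hr.le]
        exact lintegral_union_le _ _ _
    _ = _ := lintegral_add_left hmeas.lintegral_prod_right' _
    _ ≤ _ := add_le_add near far
    _ = _ := by rw [← ENNReal.ofReal_add (by positivity) (by positivity), ← add_mul]

lemma lintegral_strip_sectorKernel_le (h0 : 0 < θ₀) (hπ : θ₀ < Real.pi) (hγ : 1 < γ)
    (hγθ : γ * θ₀ = Real.pi) (hα : 0 < α) (hβ : 0 < β) {s t : ℝ} (hs : 0 < s) (ht : t ≠ 0) :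
    ∫⁻ y in Ioc 0 s, ∫⁻ x in Ioi 0,
      ENNReal.ofReal (sectorKernel γ (sectorPoint θ₀ (α * x) (β * y)) t)
      ≤ ENNReal.ofReal ((γ * (Real.pi / α) + γ / (α * Real.sin θ₀)) * s) := by
  rcases lt_or_gt_of_ne ht with h | h
  · exact lintegral_strip_sectorKernel_le_of_neg h0 hπ hγ hγθ hα hβ hs h
  · have hsin := Real.sin_pos_of_pos_of_lt_pi h0 hπ
    have hpi := Real.pi_pos
    have hγ0 : 0 < γ := by linarith
    calc _ ≤ ∫⁻ y in Ioc 0 s, ENNReal.ofReal (γ * (Real.pi / α)) :=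
          setLIntegral_mono' measurableSet_Ioc fun y hy =>
            lintegral_sectorKernel_le_of_pos h0 hπ hγ hγθ hα (mul_pos hβ hy.1) h
      _ = ENNReal.ofReal (γ * (Real.pi / α) * s) := by
          rw [setLIntegral_const, Real.volume_Ioc, sub_zero, ← ENNReal.ofReal_mul (by positivity)]
      _ ≤ _ := by
          refine ENNReal.ofReal_le_ofReal (mul_le_mul_of_nonneg_right ?_ hs.le)
          linarith [show 0 < γ / (α * Real.sin θ₀) by positivity]

lemma tendsto_lintegral_sectorKernel (h0 : 0 < θ₀) (hπ : θ₀ < Real.pi) (hγ : 1 < γ)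
    (hα : 0 < α) (hβ : 0 < β) (t : ℝ) :
    Tendsto (fun y => ∫⁻ x in Ioi 0,
      ENNReal.ofReal (sectorKernel γ (sectorPoint θ₀ (α * x) (β * y)) t)) atTop (𝓝 0) := by
  have hsin := Real.sin_pos_of_pos_of_lt_pi h0 hπ
  have hγ0 : 0 < γ := by linarith
  set q := Real.sin θ₀ / 2 * min α β with hq_def
  have hq : 0 < q := by have := lt_min hα hβ; positivity
  set A := |t| ^ (1 - 1 / γ) * (4 / q ^ γ) with hA_def
  have hA : 0 ≤ A := by positivity
  set p := (γ + 1) / 2 with hp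
  set δ := (γ - 1) / 2 with hδ_def
  have hδ : 0 < δ := by rw [hδ_def]; linarith
  have hfin : ∫⁻ x in Ioi (0 : ℝ), ENNReal.ofReal (A * (x + 1) ^ (-p)) ≠ ⊤ :=
    ((integrableOn_add_rpow_Ioi_of_lt (by rw [hp]; linarith) (by norm_num)).const_mul
      A).lintegral_lt_top.ne
  have hlim : Tendsto (fun y : ℝ => ENNReal.ofReal (y ^ (-δ)) *
      ∫⁻ x in Ioi (0 : ℝ), ENNReal.ofReal (A * (x + 1) ^ (-p))) atTop (𝓝 0) := by
    have h1 := ENNReal.tendsto_ofReal (tendsto_rpow_neg_atTop hδ)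
    have h2 := ENNReal.Tendsto.mul_const h1 (Or.inr hfin)
    simpa using h2
  refine tendsto_of_tendsto_of_tendsto_of_le_of_le' tendsto_const_nhds hlim
    (Eventually.of_forall fun _ => zero_le) ?_
  have hev : ∀ᶠ y : ℝ in atTop, 2 * |t| ≤ (q * y) ^ γ :=
    ((tendsto_rpow_atTop hγ0).comp (tendsto_id.const_mul_atTop hq)).eventually_ge_atTop _
  filter_upwards [hev, eventually_ge_atTop 1] with y hy hy1
  have hy0 : 0 < y := by linarith
  rw [← lintegral_const_mul' _ _ ENNReal.ofReal_ne_top]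
  refine setLIntegral_mono' measurableSet_Ioi fun x (hx : 0 < x) => ?_
  have hge : q * (x + y) ≤ Real.sin θ₀ / 2 * (α * x + β * y) := by
    rw [hq_def, mul_assoc]
    gcongr
    nlinarith [min_le_left α β, min_le_right α β]
  have hpow : (q * (x + y)) ^ γ ≤ (Real.sin θ₀ / 2 * (α * x + β * y)) ^ γ := by gcongr
  have hpow' : (q * y) ^ γ ≤ (q * (x + y)) ^ γ := by gcongr; linarith
  rw [← ENNReal.ofReal_mul (by positivity)]
  refine ENNReal.ofReal_le_ofReal ((sectorKernel_le_of_far h0 hπ hγ (mul_pos hα hx)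
    (mul_pos hβ hy0) (hy.trans (hpow'.trans hpow))).trans ?_)
  have hsplit : q ^ γ * ((x + 1) ^ p * y ^ δ) ≤ (q * (x + y)) ^ γ := by
    rw [Real.mul_rpow hq.le (by positivity), show γ = p + δ by rw [hp, hδ_def]; ring,
      Real.rpow_add (x := x + y) (by positivity)]
    have : 0 < p := by rw [hp]; positivity
    gcongr
    linarith
  calc _ ≤ |t| ^ (1 - 1 / γ) * (4 / (q ^ γ * ((x + 1) ^ p * y ^ δ))) := by
        gcongr; exact hsplit.trans hpow
    _ = _ := by
        rw [hA_def, Real.rpow_neg (by positivity), Real.rpow_neg (by positivity)]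
        field_simp

end Integrals

lemma tendsto_Ee {f : ℝ → ℝ≥0∞} {M : ℝ}
    (hM : ∀ s, 0 < s → ∫⁻ t in Ioc 0 s, f t ≤ ENNReal.ofReal (M * s))
    (hf : Tendsto f atTop (𝓝 0)) : Tendsto (Ee f) atTop (𝓝 0) := by
  rw [ENNReal.tendsto_nhds_zero]
  intro ε hε
  have hε2 : 0 < ε / 2 := ENNReal.half_pos hε.ne'
  obtain ⟨Y, hY⟩ := eventually_atTop.1 (ENNReal.tendsto_nhds_zero.1 hf _ hε2)
  have hY' : ∀ t, max Y 1 ≤ t → f t ≤ ε / 2 := fun t ht => hY t ((le_max_left _ _).trans ht)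
  have hY0 : 0 < max Y 1 := lt_max_of_lt_right one_pos
  generalize max Y 1 = Z at *
  have hlim : Tendsto (fun s => (ENNReal.ofReal s)⁻¹ * ENNReal.ofReal (M * Z)) atTop (𝓝 0) := by
    have h1 := ENNReal.Tendsto.mul_const (b := ENNReal.ofReal (M * Z))
      (tendsto_inv_iff.2 ENNReal.tendsto_ofReal_atTop) (Or.inr ENNReal.ofReal_ne_top)
    simpa using h1
  filter_upwards [ENNReal.tendsto_nhds_zero.1 hlim _ hε2, eventually_ge_atTop Z] with s hs hZs
  have hs0 : 0 < s := hY0.trans_le hZs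
  have hsplit : ∫⁻ t in Ioc 0 s, f t ≤ ENNReal.ofReal (M * Z) + ε / 2 * ENNReal.ofReal s := by
    rw [← Ioc_union_Ioc_eq_Ioc hY0.le hZs]
    refine (lintegral_union_le _ _ _).trans (add_le_add (hM Z hY0) ?_)
    calc ∫⁻ t in Ioc Z s, f t ≤ ∫⁻ t in Ioc Z s, ε / 2 :=
          setLIntegral_mono' measurableSet_Ioc fun t ht => hY' t ht.1.le
      _ = ε / 2 * ENNReal.ofReal (s - Z) := by rw [setLIntegral_const, Real.volume_Ioc]
      _ ≤ _ := by gcongr; linarith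
  calc Ee f s ≤ (ENNReal.ofReal s)⁻¹ * (ENNReal.ofReal (M * Z) + ε / 2 * ENNReal.ofReal s) := by
        unfold Ee; gcongr
    _ = (ENNReal.ofReal s)⁻¹ * ENNReal.ofReal (M * Z) + ε / 2 := by
        rw [mul_add, mul_comm (ε / 2), ← mul_assoc, ENNReal.inv_mul_cancel
          (ENNReal.ofReal_pos.2 hs0).ne' ENNReal.ofReal_ne_top, one_mul]
    _ ≤ ε / 2 + ε / 2 := by gcongr
    _ = ε := ENNReal.add_halves ε

lemma Ee_le {f : ℝ → ℝ≥0∞} {M s : ℝ} (hs : 0 < s)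
    (hM : ∫⁻ t in Ioc 0 s, f t ≤ ENNReal.ofReal (M * s)) : Ee f s ≤ ENNReal.ofReal M := by
  unfold Ee
  calc _ ≤ (ENNReal.ofReal s)⁻¹ * ENNReal.ofReal (M * s) := by gcongr
    _ = _ := by
        rw [ENNReal.ofReal_mul' hs.le, mul_comm, mul_assoc, ENNReal.mul_inv_cancel
          (ENNReal.ofReal_pos.2 hs).ne' ENNReal.ofReal_ne_top, mul_one]

/-- Averages of a superposition of functions `F · t` whose averages are uniformly bounded and
which vanish at infinity. -/
lemma Ee_superposition {G : ℝ → ℝ≥0∞} {h : ℝ → ℝ≥0∞} {F : ℝ → ℝ → ℝ≥0∞} {M c : ℝ} (hc : 0 ≤ c)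
    (hh : Measurable h) (hhc : ∫⁻ t, h t ≤ ENNReal.ofReal c)
    (hF : Measurable (Function.uncurry F))
    (hG : ∀ y, 0 < y → G y ≤ ∫⁻ t, h t * F y t)
    (hM : ∀ t, t ≠ 0 → ∀ s, 0 < s → ∫⁻ y in Ioc 0 s, F y t ≤ ENNReal.ofReal (M * s))
    (hlim : ∀ t, t ≠ 0 → Tendsto (fun y => F y t) atTop (𝓝 0)) :
    (∀ s, 0 < s → Ee G s ≤ ENNReal.ofReal (c * M)) ∧ Tendsto (Ee G) atTop (𝓝 0) := by
  have hne : ∀ᵐ t : ℝ, t ≠ 0 := by simp [ae_iff, measure_singleton]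
  have hmeas : ∀ s, Measurable fun t => Ee (fun y => F y t) s := fun s =>
    (hF.comp measurable_swap).lintegral_prod_right'.const_mul _
  have hle : ∀ s, 0 < s → Ee G s ≤ ∫⁻ t, h t * Ee (fun y => F y t) s := by
    intro s hs
    have hprod : Measurable fun p : ℝ × ℝ => h p.2 * F p.1 p.2 :=
      (hh.comp measurable_snd).mul hF
    have hFt : ∀ t, Measurable fun y => F y t := fun t =>
      hF.comp (measurable_id.prodMk measurable_const)
    unfold Ee
    calc _ ≤ (ENNReal.ofReal s)⁻¹ * ∫⁻ y in Ioc 0 s, ∫⁻ t, h t * F y t :=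
          mul_le_mul' le_rfl (setLIntegral_mono' measurableSet_Ioc fun y hy => hG y hy.1)
      _ = (ENNReal.ofReal s)⁻¹ * ∫⁻ t, ∫⁻ y in Ioc 0 s, h t * F y t := by
          rw [lintegral_lintegral_swap hprod.aemeasurable]
      _ = ∫⁻ t, (ENNReal.ofReal s)⁻¹ * ∫⁻ y in Ioc 0 s, h t * F y t := by
          rw [lintegral_const_mul' _ _ (ENNReal.inv_ne_top.2 (ENNReal.ofReal_pos.2 hs).ne')]
      _ = _ := by
          refine lintegral_congr fun t => ?_
          rw [lintegral_const_mul _ (hFt t)]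
          ring
  have hbound : ∀ s, 0 < s → ∀ᵐ t : ℝ,
      h t * Ee (fun y => F y t) s ≤ h t * ENNReal.ofReal M := by
    intro s hs
    filter_upwards [hne] with t ht
    gcongr
    exact Ee_le hs (hM t ht s hs)
  have htot : ∫⁻ t, h t * ENNReal.ofReal M ≤ ENNReal.ofReal (c * M) := by
    rw [lintegral_mul_const _ hh, ENNReal.ofReal_mul hc]
    gcongr
  refine ⟨fun s hs => (hle s hs).trans ((lintegral_mono_ae (hbound s hs)).trans htot), ?_⟩
  have hfin : ∀ᵐ t : ℝ, h t < ⊤ :=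
    ae_lt_top hh (hhc.trans_lt ENNReal.ofReal_lt_top).ne
  have hdom : Tendsto (fun s => ∫⁻ t, h t * Ee (fun y => F y t) s) atTop
      (𝓝 (∫⁻ _ : ℝ, 0)) := by
    refine tendsto_lintegral_filter_of_dominated_convergence (fun t => h t * ENNReal.ofReal M)
      (Eventually.of_forall fun s => hh.mul (hmeas s)) ?_
      (htot.trans_lt ENNReal.ofReal_lt_top).ne ?_
    · filter_upwards [eventually_gt_atTop 0] with s hs using hbound s hs
    · filter_upwards [hne, hfin] with t ht htop
      have := ENNReal.Tendsto.const_mul (a := h t) (tendsto_Ee (hM t ht) (hlim t ht))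
        (Or.inr htop.ne)
      simpa using this
  rw [lintegral_zero] at hdom
  refine tendsto_of_tendsto_of_tendsto_of_le_of_le' tendsto_const_nhds hdom
    (Eventually.of_forall fun _ => zero_le) ?_
  filter_upwards [eventually_gt_atTop 0] with s hs using hle s hs

lemma setLIntegral_Ici_le_superposition {g h : ℝ → ℝ≥0∞} {k : ℝ → ℝ → ℝ≥0∞} (hh : Measurable h)
    (hk : Measurable (Function.uncurry k)) (hg : ∀ x, 0 < x → g x ≤ ∫⁻ t, h t * k x t) :
    ∫⁻ x in Ici 0, g x ≤ ∫⁻ t, h t * ∫⁻ x in Ioi 0, k x t := by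
  have hprod : Measurable fun p : ℝ × ℝ => h p.2 * k p.1 p.2 := (hh.comp measurable_snd).mul hk
  have hkt : ∀ t, Measurable fun x => k x t := fun t =>
    hk.comp (measurable_id.prodMk measurable_const)
  calc _ = ∫⁻ x in Ioi 0, g x := setLIntegral_congr Ioi_ae_eq_Ici.symm
    _ ≤ ∫⁻ x in Ioi 0, ∫⁻ t, h t * k x t := setLIntegral_mono' measurableSet_Ioi hg
    _ = ∫⁻ t, ∫⁻ x in Ioi 0, h t * k x t := lintegral_lintegral_swap hprod.aemeasurable
    _ = _ := lintegral_congr fun t => lintegral_const_mul _ (hkt t)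

lemma measurable_lintegral_sectorKernel (γ θ₀ α β : ℝ) :
    Measurable (Function.uncurry fun y t : ℝ => ∫⁻ x in Ioi 0,
      ENNReal.ofReal (sectorKernel γ (sectorPoint θ₀ (α * x) (β * y)) t)) := by
  have h : Measurable fun p : (ℝ × ℝ) × ℝ =>
      ENNReal.ofReal (sectorKernel γ (sectorPoint θ₀ (α * p.2) (β * p.1.1)) p.1.2) :=
    (measurable_ofReal_sectorKernel γ θ₀ α β).comp
      (show Measurable fun p : (ℝ × ℝ) × ℝ => (p.2, p.1.1, p.1.2) by fun_prop)
  exact h.lintegral_prod_right'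

/-- The opening angle of the sector `sectorS a b`. -/
def sectorAngle (a b : ℝ) : ℝ := Complex.arg (((-a : ℝ) : ℂ) + (b : ℂ) * Complex.I)

/-- The length of the direction vector of the slanted edge of `sectorS a b`. -/
def edgeNorm (a b : ℝ) : ℝ := ‖((-a : ℝ) : ℂ) + (b : ℂ) * Complex.I‖

lemma edgeNorm_mul_cos (a b : ℝ) : edgeNorm a b * Real.cos (sectorAngle a b) = -a := by
  rw [edgeNorm, sectorAngle, Complex.norm_mul_cos_arg]; simp

lemma edgeNorm_mul_sin (a b : ℝ) : edgeNorm a b * Real.sin (sectorAngle a b) = b := by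
  rw [edgeNorm, sectorAngle, Complex.norm_mul_sin_arg]; simp

section Sector

variable {a b : ℝ}

lemma edgeNorm_pos (hb : 0 < b) : 0 < edgeNorm a b := by
  refine norm_pos_iff.2 fun h => hb.ne' ?_
  simpa using congrArg Complex.im h

lemma sectorAngle_pos (hb : 0 < b) : 0 < sectorAngle a b := by
  have hs : 0 < Real.sin (sectorAngle a b) := by
    have h1 := edgeNorm_mul_sin a b
    have h2 := edgeNorm_pos (a := a) hb
    by_contra! h
    nlinarith
  by_contra! h
  exact absurd hs
    (not_lt.2 (Real.sin_nonpos_of_nonpos_of_neg_pi_le h (Complex.neg_pi_lt_arg _).le))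

lemma sectorAngle_lt_pi (hb : 0 < b) : sectorAngle a b < Real.pi :=
  Complex.arg_lt_pi_iff.2 (Or.inr (by simpa using hb.ne'))

lemma gammaExp_mul_sectorAngle (hb : 0 < b) : gammaExp a b * sectorAngle a b = Real.pi := by
  have h := (sectorAngle_pos (a := a) hb).ne'
  rw [show gammaExp a b = Real.pi / sectorAngle a b from rfl]
  field_simp

lemma one_lt_gammaExp (hb : 0 < b) : 1 < gammaExp a b := by
  rw [show gammaExp a b = Real.pi / sectorAngle a b from rfl, one_lt_div (sectorAngle_pos hb)]
  exact sectorAngle_lt_pi hb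

lemma lam1pt_eq (s l : ℝ) :
    lam1pt a b s l = sectorPoint (sectorAngle a b) l (edgeNorm a b / b * s) := by
  apply Complex.ext
  · rw [sectorPoint_re, show edgeNorm a b / b * s * Real.cos (sectorAngle a b)
      = edgeNorm a b * Real.cos (sectorAngle a b) * (s / b) by ring, edgeNorm_mul_cos]
    simp [lam1pt, etaC, -Complex.ofReal_div]
    ring
  · rw [sectorPoint_im, show edgeNorm a b / b * s * Real.sin (sectorAngle a b)
      = edgeNorm a b * Real.sin (sectorAngle a b) * (s / b) by ring, edgeNorm_mul_sin]
    simp [lam1pt, etaC, -Complex.ofReal_div]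

lemma lam2pt_eq (s l : ℝ) :
    lam2pt a b s l = sectorPoint (sectorAngle a b) (b⁻¹ * s) (edgeNorm a b * l) := by
  apply Complex.ext
  · rw [sectorPoint_re, mul_right_comm, edgeNorm_mul_cos]
    simp [lam2pt, etaC, -Complex.ofReal_div]
    ring
  · rw [sectorPoint_im, mul_right_comm, edgeNorm_mul_sin]
    simp [lam2pt, etaC, -Complex.ofReal_div]

lemma zetaPt_eq (s : ℝ) :
    zetaPt a b s = sectorPoint (sectorAngle a b) (b⁻¹ * s) (edgeNorm a b / b * s) := by
  rw [show zetaPt a b s = lam1pt a b s (s / b) by unfold zetaPt lam1pt; ring, lam1pt_eq]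
  congr 1
  ring

lemma sectorPoint_mem_sectorS (hb : 0 < b) {X Y : ℝ} (hX : 0 < X) (hY : 0 < Y) :
    sectorPoint (sectorAngle a b) X Y ∈ sectorS a b := by
  have hs := Real.sin_pos_of_pos_of_lt_pi (sectorAngle_pos (a := a) hb) (sectorAngle_lt_pi hb)
  refine ⟨by rw [sectorPoint_im]; positivity, ?_⟩
  have h1 := edgeNorm_mul_cos a b
  have h2 := edgeNorm_mul_sin a b
  have h3 : b * (X + Y * Real.cos (sectorAngle a b)) + a * (Y * Real.sin (sectorAngle a b))
      = b * X := by
    linear_combination -Y * Real.cos (sectorAngle a b) * h2 + Y * Real.sin (sectorAngle a b) * h1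
  rw [sectorPoint_re, sectorPoint_im, h3]
  positivity

/-- The power map sends `sectorS a b` onto the upper half-plane. -/
lemma exists_mem_sectorS_cpow_eq (hb : 0 < b) {w : ℂ} (hw : 0 < w.im) :
    ∃ ζ ∈ sectorS a b, ζ ^ ((gammaExp a b : ℝ) : ℂ) = w := by
  obtain ⟨r, φ, hr, hφ, hφπ, hre, him⟩ := exists_polar_of_im_pos hw
  have hγ := one_lt_gammaExp (a := a) hb
  have hγθ := gammaExp_mul_sectorAngle (a := a) hb
  have hπ := sectorAngle_lt_pi (a := a) hb
  have h1 := edgeNorm_mul_cos a b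
  have h2 := edgeNorm_mul_sin a b
  have hm := edgeNorm_pos (a := a) hb
  set γ := gammaExp a b
  set θ₀ := sectorAngle a b
  have hγ0 : 0 < γ := by linarith
  set ρ := r ^ (1 / γ)
  have hρ : 0 < ρ := Real.rpow_pos_of_pos hr _
  have hψ : 0 < φ / γ := by positivity
  have hψ' : φ / γ < θ₀ := by rw [div_lt_iff₀ hγ0]; linarith
  have hs : 0 < Real.sin (φ / γ) := Real.sin_pos_of_pos_of_lt_pi hψ (by linarith)
  have hs' : 0 < Real.sin (θ₀ - φ / γ) := Real.sin_pos_of_pos_of_lt_pi (by linarith) (by linarith)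
  obtain ⟨h3, h4⟩ := cpow_ofReal_of_polar (γ := γ)
    (ζ := ⟨ρ * Real.cos (φ / γ), ρ * Real.sin (φ / γ)⟩) hρ hψ (by linarith) rfl rfl
  refine ⟨⟨ρ * Real.cos (φ / γ), ρ * Real.sin (φ / γ)⟩, ⟨mul_pos hρ hs, ?_⟩, ?_⟩
  · have e : b * (ρ * Real.cos (φ / γ)) + a * (ρ * Real.sin (φ / γ))
        = edgeNorm a b * ρ * Real.sin (θ₀ - φ / γ) := by
      rw [Real.sin_sub]
      linear_combination -ρ * Real.cos (φ / γ) * h2 + ρ * Real.sin (φ / γ) * h1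
    simp only [e]
    positivity
  · have h5 : ρ ^ γ = r := by rw [← Real.rpow_mul hr.le]; field_simp; simp
    have h6 : γ * (φ / γ) = φ := by field_simp
    apply Complex.ext
    · rw [h3, h5, h6, hre]
    · rw [h4, h5, h6, him]

lemma sectorPoint_cpow_im_pos (hb : 0 < b) {X Y : ℝ} (hX : 0 < X) (hY : 0 < Y) :
    0 < (sectorPoint (sectorAngle a b) X Y ^ ((gammaExp a b : ℝ) : ℂ)).im := by
  have hγ := one_lt_gammaExp (a := a) hb
  have hπ := sectorAngle_lt_pi (a := a) hb
  have hγθ := gammaExp_mul_sectorAngle (a := a) hb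
  obtain ⟨r, θ, hr, hθ, hθ0, h1, h2, -, -⟩ := sectorPoint_polar (sectorAngle_pos hb) hπ hX hY
  rw [(cpow_ofReal_of_polar hr hθ (by linarith) (by simpa) (by simpa)).2]
  exact mul_pos (by positivity) (Real.sin_pos_of_pos_of_lt_pi (by positivity) (by nlinarith))

lemma nonneg_ofReal_of_pos_sectorS (hb : 0 < b) {H Ht : ℂ → ℝ}
    (hH : ∀ z ∈ sectorS a b, 0 < H z) (hcont : ContinuousOn Ht {z : ℂ | 0 ≤ z.im})
    (hHt : ∀ ζ ∈ sectorS a b, Ht (ζ ^ ((gammaExp a b : ℝ) : ℂ)) = H ζ) (t : ℝ) :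
    0 ≤ Ht (t : ℂ) := by
  have hsub : {z : ℂ | 0 < z.im} ⊆ {z : ℂ | 0 ≤ z.im} := fun z (hz : 0 < z.im) => show 0 ≤ z.im from hz.le
  have hpos : ∀ z ∈ {z : ℂ | 0 < z.im}, 0 ≤ Ht z := by
    intro z hz
    obtain ⟨ζ, hζ, rfl⟩ := exists_mem_sectorS_cpow_eq (a := a) hb hz
    rw [hHt ζ hζ]
    exact (hH ζ hζ).le
  have hcl : (t : ℂ) ∈ closure {z : ℂ | 0 < z.im} := by
    rw [Complex.closure_setOfPred_lt_im]; simp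
  have : (𝓝[{z : ℂ | 0 < z.im}] (t : ℂ)).NeBot := mem_closure_iff_nhdsWithin_neBot.1 hcl
  exact ge_of_tendsto ((hcont (t : ℂ) (by simp)).mono hsub)
    (eventually_mem_nhdsWithin.mono hpos)

lemma ofReal_integral_le_lintegral {f : ℝ → ℝ} (hf : ∀ t, 0 ≤ f t)
    (hm : AEStronglyMeasurable f) : ENNReal.ofReal (∫ t, f t) ≤ ∫⁻ t, ENNReal.ofReal (f t) := by
  rw [integral_eq_lintegral_of_nonneg_ae (Eventually.of_forall hf) hm]
  exact ENNReal.ofReal_toReal_le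

end Sector

/-- Upper bounds for a function represented by the Poisson integral of `φ ≥ 0` at a point whose
`γ`-th power lies in the upper half-plane. -/
lemma ofReal_le_of_poisson {γ c : ℝ} {φ : ℝ → ℝ} (hφ : ∀ t, 0 ≤ φ t)
    (hφm : Measurable φ) (hφc : ∀ t, φ t ≤ c) {ζ : ℂ} (hζ : 0 < (ζ ^ (γ : ℂ)).im) {u : ℝ}
    (hu : u = (1 / Real.pi) * ∫ t : ℝ, φ t *
      ((ζ ^ (γ : ℂ)).im / ((ζ ^ (γ : ℂ)).im ^ 2 + (t - (ζ ^ (γ : ℂ)).re) ^ 2))) :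
    ENNReal.ofReal u ≤ ENNReal.ofReal c ∧
      ENNReal.ofReal u ≤ ∫⁻ t, ENNReal.ofReal (φ t * |t| ^ (-1 + 1 / γ)) *
        ENNReal.ofReal (sectorKernel γ ζ t) := by
  have hpi := Real.pi_pos
  have hc : 0 ≤ c := (hφ 0).trans (hφc 0)
  have hne : ∀ᵐ t : ℝ, t ≠ 0 := by simp [ae_iff, measure_singleton]
  have hkernel : ∀ t, t ≠ 0 → |t| ^ (-1 + 1 / γ) * sectorKernel γ ζ t = (ζ ^ (γ : ℂ)).im /
      ((ζ ^ (γ : ℂ)).im ^ 2 + (t - (ζ ^ (γ : ℂ)).re) ^ 2) := by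
    intro t ht
    rw [sectorKernel, ← mul_assoc, ← Real.rpow_add (abs_pos.2 ht)]
    simp
  generalize (ζ ^ (γ : ℂ)).im = V at *
  generalize (ζ ^ (γ : ℂ)).re = U at *
  have hP : ∀ t : ℝ, 0 < V / (V ^ 2 + (t - U) ^ 2) := fun t => by positivity
  have hint : ENNReal.ofReal (∫ t : ℝ, φ t * (V / (V ^ 2 + (t - U) ^ 2)))
      ≤ ∫⁻ t : ℝ, ENNReal.ofReal (φ t * (V / (V ^ 2 + (t - U) ^ 2))) :=
    ofReal_integral_le_lintegral (fun t => mul_nonneg (hφ t) (hP t).le)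
      (by fun_prop)
  have hI : 0 ≤ ∫ t : ℝ, φ t * (V / (V ^ 2 + (t - U) ^ 2)) :=
    integral_nonneg fun t => mul_nonneg (hφ t) (hP t).le
  constructor
  · rw [hu, ENNReal.ofReal_mul (by positivity)]
    calc _ ≤ ENNReal.ofReal (1 / Real.pi) *
          ∫⁻ t : ℝ, ENNReal.ofReal c * ENNReal.ofReal (V / (V ^ 2 + (U - 1 * t) ^ 2)) := by
          refine mul_le_mul' le_rfl (hint.trans (lintegral_mono fun t => ?_))
          rw [← ENNReal.ofReal_mul hc, one_mul, ← neg_sub, neg_sq]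
          exact ENNReal.ofReal_le_ofReal (mul_le_mul_of_nonneg_right (hφc t)
            (by rw [← neg_sub, neg_sq]; exact (hP t).le))
      _ = ENNReal.ofReal c := by
          rw [lintegral_const_mul' _ _ ENNReal.ofReal_ne_top, lintegral_poisson hζ one_pos,
            ← ENNReal.ofReal_mul hc, ← ENNReal.ofReal_mul (by positivity)]
          congr 1
          field_simp
  · have hle : u ≤ ∫ t : ℝ, φ t * (V / (V ^ 2 + (t - U) ^ 2)) := by
      rw [hu]
      refine mul_le_of_le_one_left hI ?_
      rw [div_le_one hpi]
      linarith [Real.pi_gt_three]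
    refine (ENNReal.ofReal_le_ofReal hle).trans (hint.trans (lintegral_mono_ae ?_))
    filter_upwards [hne] with t ht
    rw [← ENNReal.ofReal_mul (mul_nonneg (hφ t) (by positivity)), mul_assoc,
      hkernel t ht]

/-- The averages of `G1` for a function dominated by a superposition of sector kernels. -/
lemma Ee_G1 {a b c : ℝ} (hb : 0 < b) {H : ℂ → ℝ} {h : ℝ → ℝ≥0∞} (hc : 0 ≤ c)
    (hhm : Measurable h) (hhc : ∫⁻ t, h t ≤ ENNReal.ofReal c)
    (hpt : ∀ X Y : ℝ, 0 < X → 0 < Y →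
      ENNReal.ofReal (H (sectorPoint (sectorAngle a b) X Y)) ≤ ∫⁻ t, h t *
        ENNReal.ofReal (sectorKernel (gammaExp a b) (sectorPoint (sectorAngle a b) X Y) t)) :
    (∀ s, 0 < s → Ee (G1 a b H) s ≤ ENNReal.ofReal (c * (gammaExp a b * (Real.pi / 1) +
      gammaExp a b / (1 * Real.sin (sectorAngle a b))))) ∧
    Tendsto (Ee (G1 a b H)) atTop (𝓝 0) := by
  have h0 := sectorAngle_pos (a := a) hb
  have hπ := sectorAngle_lt_pi (a := a) hb
  have hγ := one_lt_gammaExp (a := a) hb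
  have hγθ := gammaExp_mul_sectorAngle (a := a) hb
  have hm := edgeNorm_pos (a := a) hb
  set γ := gammaExp a b
  set θ₀ := sectorAngle a b
  set m := edgeNorm a b
  exact Ee_superposition (G := G1 a b H) hc hhm hhc
    (measurable_lintegral_sectorKernel γ θ₀ 1 (m / b))
    (fun y hy => setLIntegral_Ici_le_superposition hhm
      ((measurable_ofReal_sectorKernel γ θ₀ 1 (m / b)).comp
        (show Measurable fun p : ℝ × ℝ => (p.1, y, p.2) by fun_prop))
      (fun x hx => by
        rw [lam1pt_eq, one_mul]
        exact hpt _ _ hx (by positivity)))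
    (fun t ht s hs => lintegral_strip_sectorKernel_le h0 hπ hγ hγθ one_pos
      (div_pos hm hb) hs ht)
    (fun t _ => tendsto_lintegral_sectorKernel h0 hπ hγ one_pos (div_pos hm hb) t)

/-- The averages of `G2` for a function dominated by a superposition of sector kernels. -/
lemma Ee_G2 {a b c : ℝ} (hb : 0 < b) {H : ℂ → ℝ} {h : ℝ → ℝ≥0∞} (hc : 0 ≤ c)
    (hhm : Measurable h) (hhc : ∫⁻ t, h t ≤ ENNReal.ofReal c)
    (hpt : ∀ X Y : ℝ, 0 < X → 0 < Y →
      ENNReal.ofReal (H (sectorPoint (sectorAngle a b) X Y)) ≤ ∫⁻ t, h t *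
        ENNReal.ofReal (sectorKernel (gammaExp a b) (sectorPoint (sectorAngle a b) X Y) t)) :
    (∀ s, 0 < s → Ee (G2 a b H) s ≤ ENNReal.ofReal (c * (gammaExp a b * (Real.pi / edgeNorm a b) +
      gammaExp a b / (edgeNorm a b * Real.sin (sectorAngle a b))))) ∧
    Tendsto (Ee (G2 a b H)) atTop (𝓝 0) := by
  have h0 := sectorAngle_pos (a := a) hb
  have hπ := sectorAngle_lt_pi (a := a) hb
  have hγ := one_lt_gammaExp (a := a) hb
  have hγθ := gammaExp_mul_sectorAngle (a := a) hb
  have hm := edgeNorm_pos (a := a) hb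
  set γ := gammaExp a b
  set θ₀ := sectorAngle a b
  set m := edgeNorm a b
  exact Ee_superposition (G := G2 a b H)
    (F := fun y t => ∫⁻ x in Ioi 0,
      ENNReal.ofReal (sectorKernel γ (sectorPoint θ₀ (m * x) (b⁻¹ * y)) (-t))) hc hhm hhc
    ((measurable_lintegral_sectorKernel γ θ₀ m b⁻¹).comp
      (show Measurable fun p : ℝ × ℝ => (p.1, -p.2) by fun_prop))
    (fun y hy => setLIntegral_Ici_le_superposition hhm
      ((measurable_ofReal_sectorKernel γ θ₀ m b⁻¹).comp
        (show Measurable fun p : ℝ × ℝ => (p.1, y, -p.2) by fun_prop))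
      (fun x hx => by
        have hX : 0 < b⁻¹ * y := by positivity
        have hY : 0 < m * x := by positivity
        simp only [sectorKernel_swap h0 hπ hγθ hX hY]
        rw [lam2pt_eq]
        exact hpt _ _ hX hY))
    (fun t ht s hs => lintegral_strip_sectorKernel_le h0 hπ hγ hγθ hm
      (inv_pos.2 hb) hs (neg_ne_zero.2 ht))
    (fun t _ => tendsto_lintegral_sectorKernel h0 hπ hγ hm (inv_pos.2 hb) (-t))

/-- uniform bounds and decay of the expectations `E(G₁)(s)`, `E(G₂)(s)` and
`E(s ↦ H(ζ_s))(s)` for `c`-admissible positive harmonic functions `H` on `S'`. -/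
theorem stmt4 (a b : ℝ) (hb : 0 < b) (c : ℝ) (hc : 0 < c) :
    ∃ c' : ℝ, 0 < c' ∧
      ∀ H : ℂ → ℝ, PosHarmonic a b H → Admissible a b c H →
        ((∀ s : ℝ, 0 < s →
          Ee (G1 a b H) s ≤ ENNReal.ofReal c' ∧
          Ee (G2 a b H) s ≤ ENNReal.ofReal c' ∧
          Ee (fun t => ENNReal.ofReal (H (zetaPt a b t))) s ≤ ENNReal.ofReal c') ∧
        Tendsto (fun s => Ee (G1 a b H) s) atTop (𝓝 0) ∧
        Tendsto (fun s => Ee (G2 a b H) s) atTop (𝓝 0) ∧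
        Tendsto (fun s => Ee (fun t => ENNReal.ofReal (H (zetaPt a b t))) s) atTop (𝓝 0)) := by
  have h0 := sectorAngle_pos (a := a) hb
  have hπ := sectorAngle_lt_pi (a := a) hb
  have hγ := one_lt_gammaExp (a := a) hb
  have hγθ := gammaExp_mul_sectorAngle (a := a) hb
  have hm := edgeNorm_pos (a := a) hb
  have hsin := Real.sin_pos_of_pos_of_lt_pi h0 hπ
  have hpi := Real.pi_pos
  set γ := gammaExp a b
  set θ₀ := sectorAngle a b
  set m := edgeNorm a b
  have hγ0 : 0 < γ := by linarith
  set M₁ := γ * (Real.pi / 1) + γ / (1 * Real.sin θ₀)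
  set M₂ := γ * (Real.pi / m) + γ / (m * Real.sin θ₀)
  have hM₁ : 0 < M₁ := by positivity
  have hM₂ : 0 < M₂ := by positivity
  have hc₁ : 0 < c * M₁ := by positivity
  have hc₂ : 0 < c * M₂ := by positivity
  refine ⟨c * M₁ + c * M₂ + c, by positivity, fun H hH hadm => ?_⟩
  obtain ⟨Ht, hcont, hHt, hHc, hint, hintc, hpoisson⟩ := hadm
  have hlog : 0 < Real.log 3 := Real.log_pos (by norm_num)
  have hHpos : ∀ z ∈ sectorS a b, 0 < H z := fun z hz =>
    hH.1 z ⟨by linarith [hz.1], by linarith [hz.2]⟩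
  have hφ : ∀ t : ℝ, 0 ≤ Ht (t : ℂ) := nonneg_ofReal_of_pos_sectorS hb hHpos hcont hHt
  have hφm : Measurable fun t : ℝ => Ht (t : ℂ) :=
    (hcont.comp_continuous Complex.continuous_ofReal (fun t => by simp)).measurable
  set h : ℝ → ℝ≥0∞ := fun t => ENNReal.ofReal (Ht (t : ℂ) * |t| ^ (-1 + 1 / γ))
  have habs : Measurable fun t : ℝ => |t| := continuous_abs.measurable
  have hhm : Measurable h := (hφm.mul (habs.pow_const _)).ennreal_ofReal
  have hhc : ∫⁻ t, h t ≤ ENNReal.ofReal c := by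
    rw [← ofReal_integral_eq_lintegral_ofReal hint
      (Eventually.of_forall fun t => mul_nonneg (hφ t) (by positivity))]
    exact ENNReal.ofReal_le_ofReal hintc
  have hpt : ∀ {X Y : ℝ}, 0 < X → 0 < Y →
      ENNReal.ofReal (H (sectorPoint θ₀ X Y)) ≤ ENNReal.ofReal c ∧
      ENNReal.ofReal (H (sectorPoint θ₀ X Y)) ≤
        ∫⁻ t, h t * ENNReal.ofReal (sectorKernel γ (sectorPoint θ₀ X Y) t) := by
    intro X Y hX hY
    have him := sectorPoint_cpow_im_pos (a := a) hb hX hY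
    refine ofReal_le_of_poisson hφ hφm hHc him ?_
    rw [← hHt _ (sectorPoint_mem_sectorS hb hX hY), ← hpoisson _ _ him, Complex.re_add_im]
  have hG₁ := Ee_G1 hb hc.le hhm hhc fun X Y hX hY => (hpt hX hY).2
  have hG₂ := Ee_G2 hb hc.le hhm hhc fun X Y hX hY => (hpt hX hY).2
  have hζ : ∀ y, 0 < y → ENNReal.ofReal (H (zetaPt a b y)) ≤ ENNReal.ofReal c ∧
      ENNReal.ofReal (H (zetaPt a b y)) ≤
        ENNReal.ofReal c * ENNReal.ofReal (γ / (min b⁻¹ (m / b) * Real.sin θ₀) * y⁻¹) := by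
    intro y hy
    have hX : 0 < b⁻¹ * y := by positivity
    have hY : 0 < m / b * y := by positivity
    rw [zetaPt_eq]
    refine ⟨(hpt hX hY).1, (hpt hX hY).2.trans ?_⟩
    have hne : ∀ᵐ t : ℝ, t ≠ 0 := by simp [ae_iff, measure_singleton]
    calc _ ≤ ∫⁻ t, h t * ENNReal.ofReal (γ / (min b⁻¹ (m / b) * Real.sin θ₀) * y⁻¹) := by
          refine lintegral_mono_ae ?_
          filter_upwards [hne] with t ht
          refine mul_le_mul' le_rfl (ENNReal.ofReal_le_ofReal
            ((sectorKernel_le_of_ne h0 hπ hγ hγθ hX hY ht).trans_eq ?_))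
          rw [← min_mul_of_nonneg _ _ hy.le]
          field_simp
      _ ≤ _ := by
          rw [lintegral_mul_const _ hhm]
          gcongr
  have hζ_int : ∀ s, 0 < s →
      ∫⁻ t in Ioc 0 s, ENNReal.ofReal (H (zetaPt a b t)) ≤ ENNReal.ofReal (c * s) := by
    intro s hs
    calc _ ≤ ∫⁻ t in Ioc 0 s, ENNReal.ofReal c :=
          setLIntegral_mono' measurableSet_Ioc fun t ht => (hζ t ht.1).1
      _ = _ := by
          rw [setLIntegral_const, Real.volume_Ioc, sub_zero, ← ENNReal.ofReal_mul hc.le]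
  have hζ_lim : Tendsto (fun t => ENNReal.ofReal (H (zetaPt a b t))) atTop (𝓝 0) := by
    have hlim := ENNReal.Tendsto.const_mul (a := ENNReal.ofReal c)
      (ENNReal.tendsto_ofReal
        (tendsto_inv_atTop_zero.const_mul (γ / (min b⁻¹ (m / b) * Real.sin θ₀))))
      (Or.inr ENNReal.ofReal_ne_top)
    rw [mul_zero, ENNReal.ofReal_zero, mul_zero] at hlim
    refine tendsto_of_tendsto_of_tendsto_of_le_of_le' tendsto_const_nhds hlim
      (Eventually.of_forall fun _ => zero_le) ?_
    filter_upwards [eventually_gt_atTop 0] with y hy using (hζ y hy).2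
  refine ⟨fun s hs => ⟨?_, ?_, ?_⟩, hG₁.2, hG₂.2, tendsto_Ee hζ_int hζ_lim⟩
  · exact (hG₁.1 s hs).trans (ENNReal.ofReal_le_ofReal (show c * M₁ ≤ _ by linarith))
  · exact (hG₂.1 s hs).trans (ENNReal.ofReal_le_ofReal (show c * M₂ ≤ _ by linarith))
  · exact (Ee_le hs (hζ_int s hs)).trans (ENNReal.ofReal_le_ofReal (by linarith))
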